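/- arXiv:1612.08347 — 2 statements merged into one kernel-verified Lean document; each statement's English description precedes it below -/
import Mathlib

section
/- For every ε > 0 there exists N such that for all n ≥ N, cc(L(K_n)) ≥ lg lg n − ε, where K_n is the complete graph on n vertices; that is, lg lg n − o(1) ≤ cc(L(K_n)). -/
open SimpleGraph

/-- A graph is chordal if it has no induced cycle of length more than three. -/
def IsChordal {V : Type*} (G : SimpleGraph V) : Prop :=
  ∀ n : ℕ, 3 < n → IsEmpty (cycleGraph n ↪g G)

/-- A graph is an interval graph if it is the intersection graph of a family of
closed real intervals. -/
def IsIntervalGraph {V : Type*} (G : SimpleGraph V) : Prop :=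
  ∃ a b : V → ℝ, (∀ v, a v ≤ b v) ∧
    ∀ u v, G.Adj u v ↔ u ≠ v ∧ (Set.Icc (a u) (b u) ∩ Set.Icc (a v) (b v)).Nonempty

/-- A graph is an equivalence graph if it is a disjoint union of cliques. -/
def IsEquivalenceGraph {V : Type*} (G : SimpleGraph V) : Prop :=
  ∀ u v w, G.Adj u v → G.Adj v w → u ≠ w → G.Adj u w

/-- The minimum number of graphs satisfying `P` whose (edge-)union is `G`. -/
noncomputable def coverNumber {V : Type*} (P : SimpleGraph V → Prop)
    (G : SimpleGraph V) : ℕ :=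
  sInf {k | ∃ f : Fin k → SimpleGraph V, (∀ i, P (f i)) ∧ (⨆ i, f i) = G}

/-- The chordal covering number. -/
noncomputable def chordalCoverNumber {V : Type*} (G : SimpleGraph V) : ℕ :=
  coverNumber IsChordal G

/-- The track number. -/
noncomputable def trackNumber {V : Type*} (G : SimpleGraph V) : ℕ :=
  coverNumber IsIntervalGraph G

/-- The equivalence covering number. -/
noncomputable def eqCoverNumber {V : Type*} (G : SimpleGraph V) : ℕ :=
  coverNumber IsEquivalenceGraph G

/-- An orientation of a simple graph: each edge gets exactly one of its two directions. -/
structure GraphOrientation {V : Type*} (G : SimpleGraph V) where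
  dir : V → V → Prop
  adj_iff : ∀ u v, G.Adj u v ↔ (dir u v ∨ dir v u)
  asymm : ∀ u v, dir u v → ¬ dir v u

/-- Edges `xy` and `xz` form an elbow at `x`: both towards `x` or both away from `x`. -/
def GraphOrientation.IsElbow {V : Type*} {G : SimpleGraph V} (o : GraphOrientation G)
    (x y z : V) : Prop :=
  (o.dir y x ∧ o.dir z x) ∨ (o.dir x y ∧ o.dir x z)

/-- Edges `xy` and `xz` form an in-elbow at `x`: both directed towards `x`. -/
def GraphOrientation.IsInElbow {V : Type*} {G : SimpleGraph V} (o : GraphOrientation G)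
    (x y z : V) : Prop :=
  o.dir y x ∧ o.dir z x

/-- The minimum size of an elbow cover of `G`. -/
noncomputable def elbowCoverNumber {V : Type*} (G : SimpleGraph V) : ℕ :=
  sInf {k | ∃ f : Fin k → GraphOrientation G,
    ∀ x y z, G.Adj x y → G.Adj x z → y ≠ z → ∃ i, (f i).IsElbow x y z}

/-- The minimum size of an in-elbow cover of `G`. -/
noncomputable def inElbowCoverNumber {V : Type*} (G : SimpleGraph V) : ℕ :=
  sInf {k | ∃ f : Fin k → GraphOrientation G,
    ∀ x y z, G.Adj x y → G.Adj x z → y ≠ z → ∃ i, (f i).IsInElbow x y z}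

lemma cycleGraph_adj_iff_of_lt {n : ℕ} {u v : Fin n} (h : u < v) :
    (cycleGraph n).Adj u v ↔ v.val = u.val + 1 ∨ (u.val = 0 ∧ v.val + 1 = n) := by
  rw [cycleGraph_adj', Fin.coe_sub_iff_lt.2 h, Fin.coe_sub_iff_le.2 h.le]
  have := v.isLt
  have : u.val < v.val := h
  omega

lemma exists_induced_path {V : Type*} {G : SimpleGraph V} {X : Set V}
    (hX : (G.induce X).Preconnected) {w w' a b : V} (hne : w ≠ w') (hnadj : ¬ G.Adj w w')
    (ha : a ∈ X) (hb : b ∈ X) (hwa : G.Adj w a) (hbw : G.Adj b w') :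
    ∃ (L : ℕ) (f : ℕ → V), 2 ≤ L ∧ f 0 = w ∧ f L = w' ∧ (∀ i, 0 < i → i < L → f i ∈ X) ∧
      ∀ i j, i < j → j ≤ L → f i ≠ f j ∧ (G.Adj (f i) (f j) ↔ j = i + 1) := by
  classical
  have hex : ∃ L, ∃ f : ℕ → V, f 0 = w ∧ f L = w' ∧ (∀ i, 0 < i → i < L → f i ∈ X) ∧
      ∀ i < L, G.Adj (f i) (f (i + 1)) := by
    obtain ⟨p⟩ := hX ⟨a, ha⟩ ⟨b, hb⟩
    refine ⟨p.length + 2, fun i ↦ if i = 0 then w else if i ≤ p.length + 1 then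
      (p.getVert (i - 1)).1 else w', by simp, by simp, ?_, ?_⟩
    · intro i hi hiL
      have h1 : i ≠ 0 := by omega
      have h2 : i ≤ p.length + 1 := by omega
      simp only [h1, h2, if_true, if_false]
      exact (p.getVert (i - 1)).2
    · intro i hi
      rcases Nat.eq_zero_or_pos i with rfl | h0
      · simpa using hwa
      · by_cases h1 : i = p.length + 1
        · subst h1
          simpa using hbw
        · have h2 : i ≠ 0 := by omega
          have h3 : i ≤ p.length + 1 := by omega
          have h4 : i ≤ p.length := by omega
          simp only [h2, h3, h4, if_true, if_false, Nat.add_one_ne_zero, Nat.add_le_add_iff_right,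
            Nat.add_sub_cancel]
          have := p.adj_getVert_succ (i := i - 1) (by omega)
          rw [show i - 1 + 1 = i by omega] at this
          exact this
  obtain ⟨f, h0, hL, hfX, hadj⟩ := Nat.find_spec hex
  have hmin : ∀ m, m < Nat.find hex → _ := fun m hm ↦ Nat.find_min hex hm
  generalize Nat.find hex = L at *
  refine ⟨L, f, ?_, h0, hL, hfX, ?_⟩
  · by_contra hlt
    have : L = 0 ∨ L = 1 := by omega
    rcases this with rfl | rfl
    · exact hne (h0.symm.trans hL)
    · have := hadj 0 (by omega)
      rw [h0, hL] at this
      exact hnadj this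
  · intro i j hij hjL
    have short : ∀ s, 0 < s → i + s ≤ L → f (i + s) = f i ∨ (i + s + 1 ≤ L ∧
        G.Adj (f i) (f (i + s + 1))) → False := by
      intro s hs hsL h
      refine hmin (L - s) (by omega) ⟨fun t ↦ if t ≤ i then f t else f (t + s), by simp [h0],
        ?_, ?_, ?_⟩
      · dsimp only
        split_ifs with hle
        · rcases h with h | h
          · rw [show L - s = i by omega, ← h, show i + s = L by omega, hL]
          · omega
        · rw [show L - s + s = L by omega, hL]
      · intro t ht htL
        dsimp only
        split_ifs
        · exact hfX _ ht (by omega)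
        · exact hfX _ (by omega) (by omega)
      · intro t ht
        dsimp only
        by_cases h1 : t < i
        · rw [if_pos (by omega), if_pos (by omega)]
          exact hadj _ (by omega)
        · by_cases h2 : t = i
          · subst h2
            rw [if_pos le_rfl, if_neg (by omega), show t + 1 + s = t + s + 1 by omega]
            rcases h with h | h
            · rw [← h]
              exact hadj _ (by omega)
            · exact h.2
          · rw [if_neg (by omega), if_neg (by omega), show t + 1 + s = t + s + 1 by omega]
            exact hadj _ (by omega)
    refine ⟨fun h ↦ short (j - i) (by omega) (by omega) (Or.inl ?_), fun h ↦ ?_, ?_⟩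
    · rw [show i + (j - i) = j by omega, h]
    · by_contra hne'
      refine short (j - i - 1) (by omega) (by omega) (Or.inr ⟨by omega, ?_⟩)
      rwa [show i + (j - i - 1) + 1 = j by omega]
    · rintro rfl
      exact hadj i (by omega)

lemma IsChordal.induce {V : Type*} {G : SimpleGraph V} (hG : IsChordal G) (s : Set V) :
    IsChordal (G.induce s) :=
  fun n hn ↦ ⟨fun e ↦ (hG n hn).false (e.trans (Embedding.induce s))⟩

/-- In a chordal graph, two common neighbours of a vertex `z` which also both have a neighbour in
a connected set avoiding the neighbourhood of `z` are adjacent. -/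
lemma IsChordal.adj_of_connected {V : Type*} {G : SimpleGraph V} (hG : IsChordal G) {X : Set V}
    (hX : (G.induce X).Preconnected) {w w' a b z : V} (hne : w ≠ w')
    (ha : a ∈ X) (hb : b ∈ X) (hwa : G.Adj w a) (hbw : G.Adj b w')
    (hzX : ∀ x ∈ X, x ≠ z ∧ ¬ G.Adj x z) (hzw : G.Adj w z) (hzw' : G.Adj w' z) :
    G.Adj w w' := by
  by_contra hnadj
  obtain ⟨L, f, hL2, h0, hL, hfX, hf⟩ := exists_induced_path hX hne hnadj ha hb hwa hbw
  have hz : ∀ i ≤ L, f i ≠ z ∧ (G.Adj (f i) z ↔ i = 0 ∨ i = L) := by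
    intro i hi
    rcases Nat.eq_zero_or_pos i with rfl | hi0
    · simpa [h0, hzw] using hzw.ne
    · rcases hi.eq_or_lt with rfl | hi1
      · simpa [hL, hzw'] using hzw'.ne
      · have := hzX _ (hfX i hi0 hi1)
        refine ⟨this.1, ?_⟩
        simp only [this.2, false_iff]
        omega
  let g : Fin (L + 2) → V := fun i ↦ if i.val ≤ L then f i else z
  have key : ∀ u v : Fin (L + 2), u < v →
      g u ≠ g v ∧ (G.Adj (g u) (g v) ↔ (cycleGraph (L + 2)).Adj u v) := by
    intro u v huv
    rw [cycleGraph_adj_iff_of_lt huv]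
    have huv' : u.val < v.val := huv
    have hv := v.isLt
    have hu : u.val ≤ L := by omega
    simp only [g, hu, if_true]
    split_ifs with h
    · refine ⟨(hf _ _ huv' h).1, (hf _ _ huv' h).2.trans ?_⟩
      omega
    · refine ⟨(hz _ hu).1, (hz _ hu).2.trans ?_⟩
      omega
  have hinj : Function.Injective g := by
    intro u v h
    rcases lt_trichotomy u v with hlt | rfl | hlt
    · exact absurd h (key _ _ hlt).1
    · rfl
    · exact absurd h.symm (key _ _ hlt).1
  refine (hG (L + 2) (by omega)).false ⟨⟨g, hinj⟩, ?_⟩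
  intro u v
  change G.Adj (g u) (g v) ↔ _
  rcases lt_trichotomy u v with hlt | rfl | hlt
  · exact (key _ _ hlt).2
  · simp
  · rw [G.adj_comm, (cycleGraph (L + 2)).adj_comm]
    exact (key _ _ hlt).2

/-- Every nonempty finite chordal graph has a simplicial vertex. -/
lemma IsChordal.exists_simplicial {V : Type*} [Finite V] [Nonempty V] {G : SimpleGraph V}
    (hG : IsChordal G) : ∃ v, G.IsClique (G.neighborSet v) := by
  induction hn : Nat.card V using Nat.strong_induction_on generalizing V with
  | _ n ih =>
  by_cases hall : ∀ v w, v ≠ w → G.Adj v w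
  · exact ⟨Classical.arbitrary V, fun a _ b _ hab ↦ hall a b hab⟩
  push Not at hall
  obtain ⟨v, v', hvv, hnadj⟩ := hall
  let good : Set V → Prop := fun X ↦ X.Nonempty ∧ (G.induce X).Preconnected ∧
    ∃ z, ∀ x ∈ X, x ≠ z ∧ ¬ G.Adj x z
  have hgood : good {v} := by
    refine ⟨⟨v, rfl⟩, ?_, v', ?_⟩
    · rintro ⟨a, rfl⟩ ⟨b, rfl⟩
      exact Reachable.rfl
    · rintro x rfl
      exact ⟨hvv, hnadj⟩
  obtain ⟨X, hX⟩ := (Set.toFinite {X | good X}).exists_maximal ⟨_, hgood⟩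
  obtain ⟨hXne, hXc, z₀, hz₀⟩ := hX.prop
  let Z : Set V := {z | ∀ x ∈ X, x ≠ z ∧ ¬ G.Adj x z}
  have hfull : ∀ w, w ∉ X → ∀ x ∈ X, G.Adj x w → ∀ z ∈ Z, G.Adj w z := by
    intro w hw x hx hxw z hz
    by_contra hwz
    have hins : good (insert w X) := by
      refine ⟨⟨w, Or.inl rfl⟩, ?_, z, ?_⟩
      · have h1 : (G.induce {x, w}).Connected := induce_pair_connected_of_adj hxw
        have h2 := induce_union_connected hXc h1.preconnected ⟨x, hx, Or.inl rfl⟩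
        have : X ∪ {x, w} = insert w X := by
          ext y
          simp only [Set.mem_union, Set.mem_insert_iff, Set.mem_singleton_iff]
          constructor
          · rintro (h | rfl | h) <;> tauto
          · tauto
        rw [this] at h2
        exact h2.preconnected
      · rintro y (rfl | hy)
        · refine ⟨?_, hwz⟩
          rintro rfl
          exact (hz x hx).2 hxw
        · exact hz y hy
    exact hw (hX.le_of_ge hins (Set.subset_insert _ _) (Or.inl rfl))
  obtain ⟨x₀, hx₀⟩ := hXne
  have hcard : Nat.card Z < n := by
    rw [← hn]
    exact Finite.card_subtype_lt (x := x₀) fun h ↦ (h x₀ hx₀).1 rfl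
  have : Nonempty Z := ⟨⟨z₀, hz₀⟩⟩
  obtain ⟨z, hz⟩ := ih _ hcard (hG.induce Z) rfl
  have hcase : ∀ w, G.Adj z.1 w → w ∈ Z ∨ (w ∉ X ∧ ∃ x ∈ X, G.Adj x w) := by
    intro w hw
    have hwX : w ∉ X := fun h ↦ (z.2 w h).2 hw.symm
    by_cases h : ∃ x ∈ X, G.Adj x w
    · exact Or.inr ⟨hwX, h⟩
    · push Not at h
      exact Or.inl fun x hx ↦ ⟨fun e ↦ hwX (e ▸ hx), h x hx⟩
  refine ⟨z.1, fun a ha b hb hab ↦ ?_⟩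
  rcases hcase a ha with ha' | ⟨haX, x, hx, hxa⟩
  · rcases hcase b hb with hb' | ⟨hbX, y, hy, hyb⟩
    · exact hz (x := ⟨a, ha'⟩) ha (y := ⟨b, hb'⟩) hb (fun h ↦ hab (congrArg Subtype.val h))
    · exact (hfull b hbX y hy hyb a ha').symm
  · rcases hcase b hb with hb' | ⟨hbX, y, hy, hyb⟩
    · exact hfull a haX x hx hxa b hb'
    · exact hG.adj_of_connected hXc hab hx hy hxa.symm hyb z.2 (G.adj_symm ha) (G.adj_symm hb)

/-- Every finite chordal graph has a perfect elimination ordering. -/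
lemma IsChordal.exists_elimination {V : Type*} [Finite V] {G : SimpleGraph V}
    (hG : IsChordal G) : ∃ r : V → ℕ, Function.Injective r ∧
      ∀ v, G.IsClique {w | G.Adj v w ∧ r v < r w} := by
  induction hn : Nat.card V using Nat.strong_induction_on generalizing V with
  | _ n ih =>
  rcases isEmpty_or_nonempty V with hV | hV
  · exact ⟨fun _ ↦ 0, fun v ↦ hV.elim v, fun v ↦ hV.elim v⟩
  classical
  obtain ⟨v, hv⟩ := hG.exists_simplicial
  have hcard : Nat.card ({v}ᶜ : Set V) < n := by
    rw [← hn]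
    exact Finite.card_subtype_lt (x := v) (by simp)
  obtain ⟨r, hr, hcl⟩ := ih _ hcard (hG.induce {v}ᶜ) rfl
  refine ⟨fun w ↦ if h : w = v then 0 else r ⟨w, h⟩ + 1, ?_, ?_⟩
  · intro a b hab
    by_cases ha : a = v <;> by_cases hb : b = v <;> simp [ha, hb] at hab ⊢
    exact congrArg Subtype.val (hr hab)
  · intro u a ha b hb hab
    by_cases hu : u = v
    · subst hu
      exact hv ha.1 hb.1 hab
    · have ha2 : a ≠ v := by
        rintro rfl
        simp [hu] at ha
      have hb2 : b ≠ v := by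
        rintro rfl
        simp [hu] at hb
      have ha3 := ha.2
      have hb3 := hb.2
      simp only [hu, ha2, hb2, dif_neg, not_false_eq_true, Nat.add_lt_add_iff_right] at ha3 hb3
      exact hcl ⟨u, hu⟩ (x := ⟨a, ha2⟩) ⟨ha.1, ha3⟩ (y := ⟨b, hb2⟩) ⟨hb.1, hb3⟩
        (fun h ↦ hab (congrArg Subtype.val h))

lemma isChordal_edge {V : Type*} (s t : V) : IsChordal (edge s t) := by
  intro n hn
  refine ⟨fun e ↦ ?_⟩
  have h01 : (cycleGraph n).Adj ⟨0, by omega⟩ ⟨1, by omega⟩ :=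
    (cycleGraph_adj_iff_of_lt (by simp)).2 (by simp)
  have h12 : (cycleGraph n).Adj ⟨1, by omega⟩ ⟨2, by omega⟩ :=
    (cycleGraph_adj_iff_of_lt (by simp)).2 (by simp)
  rw [← e.map_adj_iff, adj_edge] at h01 h12
  have h := h01.1.symm.trans h12.1
  rw [Sym2.eq_swap, Sym2.congr_right] at h
  simpa using e.injective h

lemma exists_chordal_cover {V : Type*} [Finite V] (G : SimpleGraph V) :
    ∃ f : Fin (chordalCoverNumber G) → SimpleGraph V, (∀ i, IsChordal (f i)) ∧ (⨆ i, f i) = G := by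
  refine Nat.sInf_mem (s := {k | ∃ f : Fin k → SimpleGraph V,
    (∀ i, IsChordal (f i)) ∧ (⨆ i, f i) = G}) ?_
  obtain ⟨k, ⟨φ⟩⟩ := Finite.exists_equiv_fin {p : V × V // G.Adj p.1 p.2}
  refine ⟨k, fun i ↦ edge (φ.symm i).1.1 (φ.symm i).1.2, fun i ↦ isChordal_edge _ _, ?_⟩
  ext a b
  rw [iSup_adj]
  constructor
  · rintro ⟨i, hi⟩
    exact ((edge_le_iff G).2 (Or.inr (φ.symm i).2)) hi
  · intro h
    refine ⟨φ ⟨(a, b), h⟩, ?_⟩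
    simp [edge_adj, h.ne]

/-- A set of pairs of edges `ab`, `ac` of a complete graph, together with a ranking of the edges
for which the later neighbours of each edge form a clique of the line graph. -/
structure ElbowElimination (V : Type*) where
  /-- The rank of the edge `ab`. -/
  rank : V → V → ℕ
  /-- The edges `ab` and `ac` are joined. -/
  join : V → V → V → Prop
  rank_comm : ∀ a b, rank a b = rank b a
  eq_of_rank_eq : ∀ a b c, a ≠ b → a ≠ c → rank a b = rank a c → b = c
  pair_eq_of_rank_eq : ∀ a b c d, a ≠ b → c ≠ d → rank a b = rank c d →
    (a = c ∧ b = d) ∨ (a = d ∧ b = c)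
  ne_of_join : ∀ a b c, join a b c → a ≠ b ∧ a ≠ c ∧ b ≠ c
  join_symm : ∀ a b c, join a b c → join a c b
  join_trans : ∀ a b c d, join a b c → join a b d → rank a b < rank a c → rank a b < rank a d →
    c ≠ d → join a c d
  eq_of_join : ∀ a b c d, join a b c → join b a d → rank a b < rank a c → rank a b < rank b d →
    c = d

/-- The triangle `xyz` is bad if both its other edges are later neighbours of `xy`. -/
def ElbowElimination.Bad {V : Type*} (H : ElbowElimination V) (x y z : V) : Prop :=
  H.join x y z ∧ H.join y x z ∧ H.rank x y < H.rank x z ∧ H.rank x y < H.rank y z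

lemma ElbowElimination.exists_orientation {V : Type*} [Finite V] (H : ElbowElimination V)
    {S : Set V} (hS : ∀ x ∈ S, ∀ y ∈ S, ∀ z ∈ S, ¬ H.Bad x y z) :
    ∃ d : V → V → Prop, (∀ a b, a ≠ b → (d a b ↔ ¬ d b a)) ∧
      ∀ a ∈ S, ∀ b ∈ S, ∀ c ∈ S, H.join a b c → (d a b ↔ d a c) := by
  classical
  obtain ⟨M, hM⟩ : ∃ M, ∀ a b, H.rank a b < M := by
    obtain ⟨M, hM⟩ := (Set.finite_range fun p : V × V ↦ H.rank p.1 p.2).bddAbove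
    exact ⟨M + 1, fun a b ↦ Nat.lt_succ_of_le (hM ⟨(a, b), rfl⟩)⟩
  have step : ∀ s, ∀ t, t + s = M → ∃ d : V → V → Prop, (∀ a b, a ≠ b → (d a b ↔ ¬ d b a)) ∧
      ∀ a ∈ S, ∀ b ∈ S, ∀ c ∈ S, H.join a b c → t ≤ H.rank a b → t ≤ H.rank a c →
        (d a b ↔ d a c) := by
    intro s
    induction s with
    | zero =>
      intro t ht
      let : LinearOrder V := linearOrderOfSTO (WellOrderingRel (α := V))
      refine ⟨fun a b ↦ a < b, fun a b hab ↦ ?_, fun a _ b _ c _ _ h ↦ ?_⟩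
      · rw [not_lt]
        exact ⟨le_of_lt, fun h ↦ lt_of_le_of_ne h hab⟩
      · have := hM a b
        omega
    | succ s ih =>
      intro t ht
      obtain ⟨d, hd, hdS⟩ := ih (t + 1) (by omega)
      by_cases hex : ∃ a ∈ S, ∃ b ∈ S, ∃ c ∈ S, H.join a b c ∧ H.rank a b = t ∧ t < H.rank a c
      · obtain ⟨a, ha, b, hb, c, hc, habc, hab, hac⟩ := hex
        have hne := H.ne_of_join _ _ _ habc
        let d' : V → V → Prop := fun x y ↦
          if x = a ∧ y = b then d a c else if x = b ∧ y = a then ¬ d a c else d x y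
        have hab' : d' a b = d a c := by simp [d']
        have hba' : d' b a = ¬ d a c := by simp [d', hne.1, hne.1.symm]
        have hother : ∀ x y, x ≠ y → H.rank x y ≠ t → d' x y = d x y := by
          intro x y hxy hr
          have h1 : ¬ (x = a ∧ y = b) := by
            rintro ⟨rfl, rfl⟩
            exact hr hab
          have h2 : ¬ (x = b ∧ y = a) := by
            rintro ⟨rfl, rfl⟩
            exact hr ((H.rank_comm _ _).trans hab)
          simp [d', h1, h2]
        have hfirst : ∀ x ∈ S, ∀ y ∈ S, ∀ z ∈ S, H.join x y z → H.rank x y = t →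
            t < H.rank x z → (d' x y ↔ d' x z) := by
          intro x hx y hy z hz hxyz hxy hxz
          have hne' := H.ne_of_join _ _ _ hxyz
          rw [hother x z hne'.2.1 (by omega)]
          rcases H.pair_eq_of_rank_eq x y a b hne'.1 hne.1 (by omega) with ⟨rfl, rfl⟩ | ⟨rfl, rfl⟩
          · rw [hab']
            by_cases hcz : c = z
            · rw [hcz]
            · exact hdS _ ha _ hc _ hz (H.join_trans _ _ _ _ habc hxyz (by omega) (by omega) hcz)
                (by omega) (by omega)
          · exfalso
            obtain rfl := H.eq_of_join _ _ _ _ habc hxyz (by omega) (by omega)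
            exact hS _ ha _ hb _ hc ⟨habc, hxyz, by omega, by omega⟩
        refine ⟨d', ?_, ?_⟩
        · intro x y hxy
          by_cases hr : H.rank x y = t
          · rcases H.pair_eq_of_rank_eq x y a b hxy hne.1 (by omega) with ⟨rfl, rfl⟩ | ⟨rfl, rfl⟩
            · rw [hab', hba', not_not]
            · rw [hab', hba']
          · rw [hother x y hxy hr, hother y x hxy.symm (by rwa [H.rank_comm])]
            exact hd x y hxy
        · intro x hx y hy z hz hxyz hxy hxz
          have hne' := H.ne_of_join _ _ _ hxyz
          rcases hxy.eq_or_lt with hxy | hxy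
          · rcases hxz.eq_or_lt with hxz | hxz
            · exact absurd (H.eq_of_rank_eq x y z hne'.1 hne'.2.1 (by omega)) hne'.2.2
            · exact hfirst x hx y hy z hz hxyz hxy.symm hxz
          · rcases hxz.eq_or_lt with hxz | hxz
            · exact (hfirst x hx z hz y hy (H.join_symm _ _ _ hxyz) hxz.symm hxy).symm
            · rw [hother x y hne'.1 (by omega), hother x z hne'.2.1 (by omega)]
              exact hdS x hx y hy z hz hxyz hxy hxz
      · refine ⟨d, hd, fun x hx y hy z hz hxyz hxy hxz ↦ ?_⟩
        have hne' := H.ne_of_join _ _ _ hxyz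
        push Not at hex
        rcases hxy.eq_or_lt with hxy | hxy
        · have := hex x hx y hy z hz hxyz hxy.symm
          exact absurd (H.eq_of_rank_eq x y z hne'.1 hne'.2.1 (by omega)) hne'.2.2
        · rcases hxz.eq_or_lt with hxz | hxz
          · have := hex x hx z hz y hy (H.join_symm _ _ _ hxyz) hxz.symm
            omega
          · exact hdS x hx y hy z hz hxyz hxy hxz
  obtain ⟨d, hd, hdS⟩ := step M 0 (by omega)
  exact ⟨d, hd, fun a ha b hb c hc h ↦ hdS a ha b hb c hc h (Nat.zero_le _) (Nat.zero_le _)⟩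

/-- If `k + 1` orientations of the complete graph on `S` cover all elbows, then `S` has at most
`2 ^ 2 ^ k` elements. -/
lemma card_le_of_elbow_cover {V : Type*} {S : Finset V} {k : ℕ} (d : Fin (k + 1) → V → V → Prop)
    (hd : ∀ i a b, a ≠ b → (d i a b ↔ ¬ d i b a))
    (hcov : ∀ a ∈ S, ∀ b ∈ S, ∀ c ∈ S, a ≠ b → a ≠ c → b ≠ c → ∃ i, d i a b ↔ d i a c) :
    S.card ≤ 2 ^ 2 ^ k := by
  let φ : S → Set (Set (Fin k)) := fun x ↦
    {u | ∃ y ∈ S, x.1 ≠ y ∧ d 0 x y ∧ ∀ i, d (Fin.succ i) x y ↔ i ∈ u}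
  have key : ∀ x y : S, x.1 ≠ y.1 → d 0 x y → φ x ≠ φ y := by
    intro x y hxy h0 h
    have hmem : {i | d (Fin.succ i) x y} ∈ φ x := ⟨y, y.2, hxy, h0, fun i ↦ Iff.rfl⟩
    rw [h] at hmem
    obtain ⟨z, hz, hyz, hz0, hzi⟩ := hmem
    have hall : ∀ i, d i y z ↔ d i x y := Fin.cases (by simp [h0, hz0]) hzi
    have hxz : x.1 ≠ z := by
      rintro rfl
      exact (hd 0 _ _ hxy).1 h0 hz0
    obtain ⟨i, hi⟩ := hcov y y.2 x x.2 z hz hxy.symm hyz hxz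
    have h1 := hall i
    have h2 := hd i _ _ hxy
    tauto
  have hinj : Function.Injective φ := by
    intro x y h
    by_contra hne
    have hxy : x.1 ≠ y.1 := fun h ↦ hne (Subtype.ext h)
    by_cases h0 : d 0 x y
    · exact key x y hxy h0 h
    · exact key y x hxy.symm ((hd 0 _ _ hxy.symm).2 h0) h.symm
  simpa using Nat.card_le_card_of_injective φ hinj

lemma card_monochromatic_mul_le {V : Type*} [Fintype V] [DecidableEq V] {m : ℕ} {x y z : V}
    (hxy : x ≠ y) (hxz : x ≠ z) (hyz : y ≠ z) :
    (Finset.univ.filter fun c : V → Fin m ↦ c x = c z ∧ c y = c z).card * m ^ 2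
      ≤ Fintype.card (V → Fin m) := by
  have h := Finset.card_le_card_of_injOn (s := (Finset.univ.filter fun c : V → Fin m ↦
    c x = c z ∧ c y = c z) ×ˢ (Finset.univ : Finset (Fin m × Fin m))) (t := Finset.univ)
    (fun p ↦ Function.update (Function.update p.1 y p.2.1) z p.2.2)
    (fun _ _ ↦ Finset.mem_coe.2 (Finset.mem_univ _)) ?_
  · simpa [Finset.card_product, sq] using h
  · rintro ⟨c, p, q⟩ hc ⟨c', p', q'⟩ hc' h
    simp only [Finset.coe_product, Set.mem_prod, Finset.mem_coe, Finset.mem_filter,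
      Finset.mem_univ, true_and, and_true] at hc hc'
    dsimp only at h
    have hx := congrFun h x
    have hy := congrFun h y
    have hz := congrFun h z
    simp only [Function.update_self, Function.update_of_ne hyz, Function.update_of_ne hxz,
      Function.update_of_ne hxy] at hx hy hz
    have : c = c' := by
      funext w
      by_cases hwz : w = z
      · rw [hwz, ← hc.1, ← hc'.1, hx]
      by_cases hwy : w = y
      · rw [hwy, hc.2, hc'.2, ← hc.1, ← hc'.1, hx]
      simpa [Function.update_of_ne hwz, Function.update_of_ne hwy] using congrFun h w
    rw [this, hy, hz]

/-- A sparse family of triples has a large independent set. -/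
lemma exists_independent_of_triples {V : Type*} [Fintype V] [DecidableEq V] {m : ℕ} (hm : 0 < m)
    (T : Finset (V × V × V))
    (hT : ∀ t ∈ T, t.1 ≠ t.2.1 ∧ t.1 ≠ t.2.2 ∧ t.2.1 ≠ t.2.2)
    (hcard : 2 * T.card ≤ m ^ 2 * Fintype.card V) :
    ∃ S : Finset V, Fintype.card V ≤ 2 * m * S.card ∧
      ∀ t ∈ T, ¬ (t.1 ∈ S ∧ t.2.1 ∈ S ∧ t.2.2 ∈ S) := by
  have : NeZero m := ⟨hm.ne'⟩
  let mono : (V → Fin m) → Finset (V × V × V) := fun c ↦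
    T.filter fun t ↦ c t.1 = c t.2.2 ∧ c t.2.1 = c t.2.2
  obtain ⟨c, -, hc⟩ : ∃ c ∈ (Finset.univ : Finset (V → Fin m)),
      (mono c).card * m ^ 2 ≤ T.card := by
    refine Finset.exists_le_of_sum_le Finset.univ_nonempty ?_
    calc ∑ c, (mono c).card * m ^ 2
        = ∑ t ∈ T, (Finset.univ.filter fun c : V → Fin m ↦
            c t.1 = c t.2.2 ∧ c t.2.1 = c t.2.2).card * m ^ 2 := by
          rw [← Finset.sum_mul, ← Finset.sum_mul]
          congr 1
          exact Finset.sum_card_bipartiteAbove_eq_sum_card_bipartiteBelow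
            (fun (c : V → Fin m) (t : V × V × V) ↦ c t.1 = c t.2.2 ∧ c t.2.1 = c t.2.2)
      _ ≤ ∑ t ∈ T, Fintype.card (V → Fin m) := Finset.sum_le_sum fun t ht ↦
          card_monochromatic_mul_le (hT t ht).1 (hT t ht).2.1 (hT t ht).2.2
      _ = ∑ c : V → Fin m, T.card := by
          simp [mul_comm]
  have hmono : 2 * (mono c).card ≤ Fintype.card V := by
    refine le_of_mul_le_mul_left (a := m ^ 2) ?_ (by positivity)
    linarith
  let R : Finset V := (mono c).image fun t ↦ t.2.2
  have hR : R.card ≤ (mono c).card := Finset.card_image_le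
  have hRc : R.card + Rᶜ.card = Fintype.card V := Finset.card_add_card_compl R
  obtain ⟨a, ha⟩ : ∃ a, Rᶜ.card ≤ m * (Rᶜ.filter fun v ↦ c v = a).card := by
    by_contra! h
    have h1 := Finset.sum_lt_sum_of_nonempty (Finset.univ_nonempty (α := Fin m))
      (fun a _ ↦ h a)
    rw [← Finset.mul_sum, ← Finset.card_eq_sum_card_fiberwise (fun _ _ ↦ by simp)] at h1
    simp at h1
  refine ⟨Rᶜ.filter fun v ↦ c v = a, by linarith, ?_⟩
  rintro ⟨x, y, z⟩ ht ⟨hx, hy, hz⟩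
  simp only [Finset.mem_filter, Finset.mem_compl] at hx hy hz
  refine hz.1 (Finset.mem_image.2 ⟨(x, y, z), ?_, rfl⟩)
  simp [mono, ht, hx.2, hy.2, hz.2]

lemma lineGraph_adj_share {V : Type*} {G : SimpleGraph V} {a b c d : V} {h : s(a, b) ∈ G.edgeSet}
    {h' : s(c, d) ∈ G.edgeSet} (hadj : G.lineGraph.Adj ⟨s(a, b), h⟩ ⟨s(c, d), h'⟩) :
    a = c ∨ a = d ∨ b = c ∨ b = d := by
  obtain ⟨v, hv, hv'⟩ := hadj.2
  simp only [Sym2.coe_mk, Set.mem_insert_iff, Set.mem_singleton_iff] at hv hv'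
  grind

/-- The edge `ab` of the complete graph, as a vertex of its line graph. -/
def completeEdge {V : Type*} {a b : V} (h : a ≠ b) : (completeGraph V).edgeSet :=
  ⟨s(a, b), h⟩

lemma completeEdge_comm {V : Type*} {a b : V} (h : a ≠ b) :
    completeEdge h = completeEdge h.symm :=
  Subtype.ext Sym2.eq_swap

lemma completeEdge_eq_iff {V : Type*} {a b c d : V} (h : a ≠ b) (h' : c ≠ d) :
    completeEdge h = completeEdge h' ↔ (a = c ∧ b = d) ∨ (a = d ∧ b = c) :=
  Subtype.ext_iff.trans Sym2.eq_iff

lemma IsChordal.exists_elbowElimination {V : Type*} [Finite V]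
    {H : SimpleGraph (completeGraph V).edgeSet} (hH : IsChordal H)
    (hle : H ≤ (completeGraph V).lineGraph) :
    ∃ E : ElbowElimination V, ∀ a b c (hab : a ≠ b) (hac : a ≠ c),
      H.Adj (completeEdge hab) (completeEdge hac) → E.join a b c := by
  classical
  obtain ⟨r, hr, hcl⟩ := hH.exists_elimination
  let rank : V → V → ℕ := fun a b ↦ if h : a ≠ b then r (completeEdge h) else 0
  have hrank : ∀ {a b} (h : a ≠ b), rank a b = r (completeEdge h) := fun h ↦ dif_pos h
  have pair_eq : ∀ a b c d, a ≠ b → c ≠ d → rank a b = rank c d →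
      (a = c ∧ b = d) ∨ (a = d ∧ b = c) := by
    intro a b c d hab hcd h
    rw [hrank hab, hrank hcd] at h
    exact (completeEdge_eq_iff hab hcd).1 (hr h)
  refine ⟨{
    rank := rank
    join := fun a b c ↦ ∃ (hab : a ≠ b) (hac : a ≠ c), H.Adj (completeEdge hab) (completeEdge hac)
    rank_comm := ?_
    eq_of_rank_eq := ?_
    pair_eq_of_rank_eq := pair_eq
    ne_of_join := ?_
    join_symm := ?_
    join_trans := ?_
    eq_of_join := ?_ }, fun a b c hab hac h ↦ ⟨hab, hac, h⟩⟩
  · intro a b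
    by_cases h : a = b
    · rw [h]
    · rw [hrank h, hrank (Ne.symm h), completeEdge_comm]
  · intro a b c hab hac h
    rcases pair_eq a b a c hab hac h with h | h
    · exact h.2
    · exact absurd h.1 hac
  · rintro a b c ⟨hab, hac, h⟩
    refine ⟨hab, hac, ?_⟩
    rintro rfl
    exact h.ne rfl
  · rintro a b c ⟨hab, hac, h⟩
    exact ⟨hac, hab, h.symm⟩
  · rintro a b c d ⟨hab, hac, h⟩ ⟨_, had, h'⟩ hr1 hr2 hcd
    rw [hrank hab, hrank hac] at hr1
    rw [hrank hab, hrank had] at hr2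
    refine ⟨hac, had, hcl _ ⟨h, hr1⟩ ⟨h', hr2⟩ ?_⟩
    rw [ne_eq, completeEdge_eq_iff]
    tauto
  · rintro a b c d ⟨hab, hac, h⟩ ⟨hba, hbd, h'⟩ hr1 hr2
    rw [hrank hab, hrank hac] at hr1
    rw [hrank hab, hrank hbd] at hr2
    rw [completeEdge_comm hba] at h'
    have hbc : b ≠ c := by
      rintro rfl
      exact h.ne rfl
    have had : a ≠ d := by
      rintro rfl
      exact h'.ne (completeEdge_comm _)
    have hadj : H.Adj (completeEdge hac) (completeEdge hbd) := by
      refine hcl _ ⟨h, hr1⟩ ⟨h', hr2⟩ ?_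
      rw [ne_eq, completeEdge_eq_iff]
      tauto
    rcases lineGraph_adj_share (hle hadj) with h | h | h | h
    · exact absurd h hab
    · exact absurd h had
    · exact absurd h.symm hbc
    · exact h

lemma ElbowElimination.bad_unique {V : Type*} (E : ElbowElimination V) {x y z z' : V}
    (h : E.Bad x y z) (h' : E.Bad x y z') : z = z' :=
  E.eq_of_join _ _ _ _ h.1 h'.2.1 h.2.2.1 h'.2.2.2

/-- If `L(K_n)` is a union of `k` chordal graphs, then `n ≤ 32 * k * 2 ^ 2 ^ k`. -/
lemma le_of_chordal_cover {n k : ℕ} (hn : 3 ≤ n)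
    (f : Fin k → SimpleGraph (completeGraph (Fin n)).edgeSet) (hf : ∀ i, IsChordal (f i))
    (hcov : (⨆ i, f i) = (completeGraph (Fin n)).lineGraph) : n ≤ 32 * k * 2 ^ 2 ^ k := by
  classical
  have hjoin : ∀ a b c : Fin n, ∀ (hab : a ≠ b) (hac : a ≠ c), b ≠ c →
      ∃ i, (f i).Adj (completeEdge hab) (completeEdge hac) := by
    intro a b c hab hac hbc
    rw [← iSup_adj, hcov]
    refine ⟨?_, a, by simp [completeEdge], by simp [completeEdge]⟩
    rw [ne_eq, completeEdge_eq_iff]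
    tauto
  obtain rfl | ⟨k, rfl⟩ : k = 0 ∨ ∃ k', k = k' + 1 := by
    cases k <;> simp
  · obtain ⟨i, -⟩ := hjoin ⟨0, by omega⟩ ⟨1, by omega⟩ ⟨2, by omega⟩ (by simp) (by simp) (by simp)
    exact i.elim0
  choose E hE using fun i ↦ (hf i).exists_elbowElimination (hcov ▸ le_iSup f i)
  let T : Finset (Fin n × Fin n × Fin n) :=
    Finset.univ.filter fun t ↦ ∃ i, (E i).Bad t.1 t.2.1 t.2.2
  have hTne : ∀ t ∈ T, t.1 ≠ t.2.1 ∧ t.1 ≠ t.2.2 ∧ t.2.1 ≠ t.2.2 := by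
    intro t ht
    obtain ⟨i, hi⟩ := (Finset.mem_filter.1 ht).2
    exact (E i).ne_of_join _ _ _ hi.1
  have hTcard : T.card ≤ (k + 1) * n ^ 2 := by
    have hT : ∀ t : T, ∃ i, (E i).Bad t.1.1 t.1.2.1 t.1.2.2 :=
      fun t ↦ (Finset.mem_filter.1 t.2).2
    choose j hj using hT
    have := Fintype.card_le_of_injective
      (fun t : T ↦ ((j t, t.1.1, t.1.2.1) : Fin (k + 1) × Fin n × Fin n)) ?_
    · simpa [sq] using this
    · rintro s t h
      simp only [Prod.mk.injEq] at h
      obtain ⟨h1, h2, h3⟩ := h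
      have hs := hj s
      rw [h1, h2, h3] at hs
      exact Subtype.ext (Prod.ext h2 (Prod.ext h3 ((E _).bad_unique hs (hj t))))
  set q := 2 * (k + 1) * n with hq
  have hqpos : 0 < Nat.sqrt q := Nat.sqrt_pos.2 (by positivity)
  have hlt := Nat.lt_succ_sqrt q
  have hle := Nat.sqrt_le q
  rw [Nat.succ_eq_add_one] at hlt
  obtain ⟨S, hS, hST⟩ := exists_independent_of_triples (m := Nat.sqrt q + 1) (by omega) T hTne (by
    rw [Fintype.card_fin]
    calc 2 * T.card ≤ q * n := by rw [hq]; linarith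
      _ ≤ _ := Nat.mul_le_mul_right _ (by rw [sq]; exact hlt.le))
  have hor : ∀ i, _ := fun i ↦ (E i).exists_orientation (S := S) (by
    intro x hx y hy z hz hbad
    exact hST (x, y, z) (Finset.mem_filter.2 ⟨Finset.mem_univ _, i, hbad⟩) ⟨hx, hy, hz⟩)
  choose d hd hdS using hor
  have hcard := card_le_of_elbow_cover (S := S) d hd (by
    intro a ha b hb c hc hab hac hbc
    obtain ⟨i, hi⟩ := hjoin a b c hab hac hbc
    exact ⟨i, hdS i a ha b hb c hc (hE i a b c hab hac hi)⟩)
  rw [Fintype.card_fin] at hS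
  have h1 : n ≤ 4 * Nat.sqrt q * 2 ^ 2 ^ k :=
    calc n ≤ 2 * (Nat.sqrt q + 1) * S.card := hS
      _ ≤ 4 * Nat.sqrt q * 2 ^ 2 ^ k := Nat.mul_le_mul (by omega) hcard
  have h2 : n * n ≤ (32 * (k + 1) * 2 ^ 2 ^ (k + 1)) * n :=
    calc n * n ≤ (4 * Nat.sqrt q * 2 ^ 2 ^ k) * (4 * Nat.sqrt q * 2 ^ 2 ^ k) :=
          Nat.mul_le_mul h1 h1
      _ = 16 * (Nat.sqrt q * Nat.sqrt q) * 2 ^ 2 ^ (k + 1) := by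
          rw [show 2 ^ (k + 1) = 2 ^ k + 2 ^ k by ring, pow_add]
          ring
      _ ≤ 16 * q * 2 ^ 2 ^ (k + 1) := by gcongr
      _ = _ := by rw [hq]; ring
  exact Nat.le_of_mul_le_mul_right h2 (by omega)

lemma logb_logb_le {δ : ℝ} {n k : ℕ} (hn : 3 ≤ n) (hδ : (5 + k : ℝ) ≤ (2 ^ δ - 1) * 2 ^ k)
    (h : n ≤ 32 * k * 2 ^ 2 ^ k) : Real.logb 2 (Real.logb 2 n) ≤ k + δ := by
  have hn0 : (0 : ℝ) < n := by positivity
  have hk : k ≤ 2 ^ k := Nat.lt_two_pow_self.le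
  have h1 : n ≤ 2 ^ (5 + k + 2 ^ k) := by
    refine h.trans ?_
    rw [pow_add, pow_add]
    gcongr
    norm_num
  have h2 : Real.logb 2 n ≤ 5 + k + 2 ^ k := by
    rw [Real.logb_le_iff_le_rpow (by norm_num) hn0]
    have h3 : (n : ℝ) ≤ 2 ^ (5 + k + 2 ^ k) := by exact_mod_cast h1
    rw [← Real.rpow_natCast] at h3
    exact_mod_cast h3
  have hpos : 0 < Real.logb 2 n := Real.logb_pos (by norm_num) (by
    have : (3 : ℝ) ≤ n := by exact_mod_cast hn
    linarith)
  rw [Real.logb_le_iff_le_rpow (by norm_num) hpos, Real.rpow_add (by norm_num), Real.rpow_natCast]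
  linarith

lemma exists_forall_add_le_mul_two_pow {c : ℝ} (hc : 0 < c) :
    ∃ K : ℕ, ∀ k : ℕ, K ≤ k → (5 + k : ℝ) ≤ c * 2 ^ k := by
  have h1 : Filter.Tendsto (fun k : ℕ ↦ (5 : ℝ) * (1 / 2) ^ k + k * (1 / 2) ^ k)
      Filter.atTop (nhds 0) := by
    have ha := (tendsto_pow_atTop_nhds_zero_of_lt_one (r := (1 / 2 : ℝ)) (by norm_num)
      (by norm_num)).const_mul 5
    have hb := tendsto_self_mul_const_pow_of_lt_one (r := (1 / 2 : ℝ)) (by norm_num) (by norm_num)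
    simpa using ha.add hb
  obtain ⟨K, hK⟩ := Filter.eventually_atTop.1 (h1.eventually_le_const hc)
  refine ⟨K, fun k hk ↦ ?_⟩
  have := mul_le_mul_of_nonneg_right (hK k hk) (show (0 : ℝ) ≤ 2 ^ k by positivity)
  rwa [← add_mul, mul_assoc, ← mul_pow, show (1 / 2 : ℝ) * 2 = 1 by norm_num, one_pow,
    mul_one] at this

theorem stmt_4 (ε : ℝ) (hε : 0 < ε) :
    ∃ N : ℕ, ∀ n : ℕ, N ≤ n →
      Real.logb 2 (Real.logb 2 n) - ε
        ≤ (chordalCoverNumber (completeGraph (Fin n)).lineGraph : ℝ) := by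
  obtain ⟨K, hK⟩ := exists_forall_add_le_mul_two_pow
    (sub_pos.2 (Real.one_lt_rpow one_lt_two hε))
  refine ⟨32 * K * 2 ^ 2 ^ K + 3, fun n hn ↦ ?_⟩
  obtain ⟨f, hf, hcov⟩ := exists_chordal_cover (completeGraph (Fin n)).lineGraph
  have h := le_of_chordal_cover (by omega) f hf hcov
  rw [sub_le_iff_le_add]
  refine logb_logb_le (by omega) (hK _ ?_) h
  by_contra! hlt
  have : 32 * chordalCoverNumber (completeGraph (Fin n)).lineGraph *
      2 ^ 2 ^ chordalCoverNumber (completeGraph (Fin n)).lineGraph ≤ 32 * K * 2 ^ 2 ^ K := by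
    gcongr <;> norm_num
  omega
end

section
/- For every simple graph G, elb(G) ≤ 2·eq(L(G)): from any cover of L(G) by k equivalence graphs one can construct an elbow cover of G using 2k orientations, since the three pairs of adjacent edges in a triangle of G can be elbow-covered using two orientations. -/
open SimpleGraph

/-- The orientation of `G` directing each edge `e` towards its chosen endpoint `head e`. -/
def GraphOrientation.ofHead {V : Type*} {G : SimpleGraph V} (head : G.edgeSet → V)
    (mem : ∀ e, head e ∈ e.1) : GraphOrientation G where
  dir u v := ∃ h : G.Adj u v, head ⟨s(u, v), h⟩ = v
  adj_iff u v := by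
    constructor
    · intro h
      rcases Sym2.mem_iff.1 (mem ⟨s(u, v), h⟩) with hu | hv
      · refine Or.inr ⟨h.symm, Eq.trans ?_ hu⟩
        congr 2
        exact Sym2.eq_swap
      · exact Or.inl ⟨h, hv⟩
    · rintro (⟨h, -⟩ | ⟨h, -⟩)
      · exact h
      · exact h.symm
  asymm u v := by
    rintro ⟨h, hv⟩ ⟨h', hu⟩
    refine h.ne (hu.symm.trans (Eq.trans ?_ hv))
    congr 2
    exact Sym2.eq_swap

lemma GraphOrientation.ofHead_dir_left {V : Type*} {G : SimpleGraph V} {head : G.edgeSet → V}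
    {mem : ∀ e, head e ∈ e.1} {x y : V} (h : G.Adj x y) (hx : head ⟨s(x, y), h⟩ = x) :
    (ofHead head mem).dir y x := by
  refine ⟨h.symm, Eq.trans ?_ hx⟩
  congr 2
  exact Sym2.eq_swap

/-- The edges in one component of an equivalence subgraph of the line graph all meet a common
edge `s(p e, q e)`. -/
lemma IsEquivalenceGraph.exists_common_edge {V : Type*} {G : SimpleGraph V}
    {H : SimpleGraph G.edgeSet} (hH : IsEquivalenceGraph H) (hle : H ≤ G.lineGraph) :
    ∃ p q : G.edgeSet → V, (∀ e, p e ∈ e.1 ∨ q e ∈ e.1) ∧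
      ∀ e f, H.Adj e f → p e = p f ∧ q e = q f := by
  let S : Setoid G.edgeSet :=
    { r := fun e f => e = f ∨ H.Adj e f
      iseqv :=
        { refl := fun _ => Or.inl rfl
          symm := by
            rintro e f (h | h)
            · exact Or.inl h.symm
            · exact Or.inr h.symm
          trans := by
            rintro e f g (rfl | h) (rfl | h')
            · exact Or.inl rfl
            · exact Or.inr h'
            · exact Or.inr h
            · by_cases heg : e = g
              · exact Or.inl heg
              · exact Or.inr (hH _ _ _ h h' heg) } }
  let rep : G.edgeSet → G.edgeSet := fun e => (Quotient.mk S e).out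
  have hrep : ∀ e, rep e = e ∨ H.Adj (rep e) e := fun e => Quotient.mk_out (s := S) e
  refine ⟨fun e => (rep e).1.out.1, fun e => (rep e).1.out.2, fun e => ?_, fun e f h => ?_⟩
  · have hmeet : ∃ v, v ∈ (rep e).1 ∧ v ∈ e.1 := by
      rcases hrep e with h | h
      · exact ⟨_, Sym2.out_fst_mem (rep e).1, by rw [h]; exact Sym2.out_fst_mem e.1⟩
      · obtain ⟨-, v, hv⟩ := lineGraph_adj_iff_exists.1 (hle h)
        exact ⟨v, hv⟩
    obtain ⟨v, hv, hve⟩ := hmeet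
    have hout : (rep e).1 = s((rep e).1.out.1, (rep e).1.out.2) := (Quot.out_eq _).symm
    rw [hout, Sym2.mem_iff] at hv
    rcases hv with rfl | rfl
    · exact Or.inl hve
    · exact Or.inr hve
  · have : rep e = rep f := congrArg Quotient.out (Quotient.sound (s := S) (Or.inr h))
    simp only [this, and_self]

/-- Two orientations suffice to make elbows of all pairs of edges adjacent in an equivalence
subgraph of the line graph. -/
lemma IsEquivalenceGraph.exists_orientations {V : Type*} {G : SimpleGraph V}
    {H : SimpleGraph G.edgeSet} (hH : IsEquivalenceGraph H) (hle : H ≤ G.lineGraph) :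
    ∃ o₁ o₂ : GraphOrientation G, ∀ x y z (hy : G.Adj x y) (hz : G.Adj x z),
      H.Adj ⟨s(x, y), hy⟩ ⟨s(x, z), hz⟩ → o₁.IsElbow x y z ∨ o₂.IsElbow x y z := by
  classical
  obtain ⟨p, q, hpq, hconst⟩ := hH.exists_common_edge hle
  have hfst : ∀ e : G.edgeSet, (if p e ∈ e.1 then p e else q e) ∈ e.1 := fun e => by
    have := hpq e
    split_ifs <;> tauto
  have hsnd : ∀ e : G.edgeSet, (if q e ∈ e.1 then q e else p e) ∈ e.1 := fun e => by
    have := hpq e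
    split_ifs <;> tauto
  refine ⟨.ofHead _ hfst, .ofHead _ hsnd, fun x y z hy hz h => ?_⟩
  obtain ⟨hp, hq⟩ := hconst _ _ h
  by_cases hxp : p ⟨s(x, y), hy⟩ = x
  · refine Or.inl (Or.inl ⟨GraphOrientation.ofHead_dir_left hy ?_,
      GraphOrientation.ofHead_dir_left hz ?_⟩)
    · simp [hxp]
    · simp [← hp, hxp]
  by_cases hxq : q ⟨s(x, y), hy⟩ = x
  · refine Or.inr (Or.inl ⟨GraphOrientation.ofHead_dir_left hy ?_,
      GraphOrientation.ofHead_dir_left hz ?_⟩)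
    · simp [hxq]
    · simp [← hq, hxq]
  have hhead : ∀ w (hw : G.Adj x w), p ⟨s(x, w), hw⟩ ≠ x → q ⟨s(x, w), hw⟩ ≠ x →
      (GraphOrientation.ofHead _ hfst).dir x w := by
    intro w hw hpw hqw
    refine ⟨hw, (Sym2.mem_iff.1 (hfst ⟨s(x, w), hw⟩)).resolve_left ?_⟩
    split_ifs
    · exact hpw
    · exact hqw
  exact Or.inl (Or.inr ⟨hhead y hy hxp hxq, hhead z hz (hp ▸ hxp) (hq ▸ hxq)⟩)

/-- Every finite graph is a union of finitely many equivalence graphs. -/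
lemma exists_eqCover {W : Type*} [Finite W] (L : SimpleGraph W) :
    ∃ k, ∃ f : Fin k → SimpleGraph W, (∀ i, IsEquivalenceGraph (f i)) ∧ (⨆ i, f i) = L := by
  obtain ⟨k, ⟨g⟩⟩ := Finite.exists_equiv_fin {a : W × W // L.Adj a.1 a.2}
  refine ⟨k, fun i => edge (g.symm i).1.1 (g.symm i).1.2, fun i u v w huv hvw huw => ?_, ?_⟩
  · simp only [edge_adj] at huv hvw
    grind
  · ext u v
    simp only [iSup_adj, edge_adj]
    constructor
    · rintro ⟨i, ⟨rfl, rfl⟩ | ⟨rfl, rfl⟩, -⟩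
      · exact (g.symm i).2
      · exact (g.symm i).2.symm
    · intro h
      exact ⟨g ⟨(u, v), h⟩, by simp, h.ne⟩

theorem stmt_8 {V : Type*} [Fintype V] (G : SimpleGraph V) :
    elbowCoverNumber G ≤ 2 * eqCoverNumber G.lineGraph := by
  obtain ⟨f, hf, hsup⟩ := Nat.sInf_mem (exists_eqCover G.lineGraph)
  choose o₁ o₂ ho using fun i => (hf i).exists_orientations (hsup ▸ le_iSup f i)
  refine Nat.sInf_le ⟨fun i => let a := finProdFinEquiv.symm i
    ![o₁ a.2, o₂ a.2] a.1, ?_⟩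
  intro x y z hy hz hyz
  have hadj : G.lineGraph.Adj ⟨s(x, y), hy⟩ ⟨s(x, z), hz⟩ :=
    lineGraph_adj_iff_exists.2 ⟨fun h => hyz (Sym2.congr_right.1 (congrArg Subtype.val h)), x, by simp, by simp⟩
  rw [← hsup, iSup_adj] at hadj
  obtain ⟨i, hi⟩ := hadj
  rcases ho i x y z hy hz hi with h | h
  · exact ⟨finProdFinEquiv (0, i), by simpa using h⟩
  · exact ⟨finProdFinEquiv (1, i), by simpa using h⟩
end
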